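/- arXiv:1512.05335 — 2 statements merged into one kernel-verified Lean document; each statement's English description precedes it below -/
import Mathlib

section
/- Let n ≥ 1 and let ω = (Y₁, …, Y_n) where the Y_i are independent Bernoulli random variables with parameters r_i ∈ (0,1). Then on some probability space one can construct random configurations ω̃_[0] = (0,…,0), ω̃_[1], …, ω̃_[n] = (1,…,1) in {0,1}^n such that: (a) for every 0 ≤ i ≤ n−1, ω̃_[i+1] is obtained from ω̃_[i] by switching exactly one coordinate from 0 to 1 (in particular |ω̃_[i]| = i for each i, where |ω| is the number of 1-coordinates); and (b) for every 0 ≤ i ≤ n, ω̃_[i] has the same distribution as ω conditioned on {|ω| = i}. -/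
open MeasureTheory

namespace MonoCoupling

open Finset

variable {n : ℕ}

lemma card_sdiff_pos_of {m : ℕ} {S U : Finset (Fin n)} (hS : S.card = m) (hU : U.card = m + 1) :
    0 < (U \ S).card := by
  have := Finset.le_card_sdiff S U
  omega

lemma swap_sum (x : Fin n → ℝ) (m : ℕ) (g : Finset (Fin n) → ℝ) :
    ∑ S ∈ powersetCard m univ, ∑ U ∈ powersetCard (m+1) univ, ∑ j ∈ U \ S,
      (∏ k ∈ S, x k) * (∏ k ∈ U, x k) / ((U \ S).card : ℝ) * g (insert j S)
    = ∑ T ∈ powersetCard (m+1) univ, ∑ V ∈ powersetCard m univ, 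
      (∏ k ∈ T, x k) * (∏ k ∈ V, x k) * g T := by
  have h1 : ∑ T ∈ powersetCard (m+1) univ, ∑ V ∈ powersetCard m univ, 
      (∏ k ∈ T, x k) * (∏ k ∈ V, x k) * g T = 
      ∑ T ∈ powersetCard (m+1) univ, ∑ V ∈ powersetCard m univ, ∑ j ∈ T \ V,
      (∏ k ∈ T, x k) * (∏ k ∈ V, x k) / ((T \ V).card : ℝ) * g T := by
    refine sum_congr rfl fun T hT => sum_congr rfl fun V hV => ?_
    rw [mem_powersetCard_univ] at hT hV
    have := card_sdiff_pos_of hV hT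
    have h' : ((T \ V).card : ℝ) ≠ 0 := by positivity
    rw [sum_const, nsmul_eq_mul]
    field_simp
  rw [h1]
  simp only [sum_sigma']
  refine sum_bij' (fun p _ => ⟨insert p.2.2 p.1, p.2.1.erase p.2.2, p.2.2⟩)
    (fun p _ => ⟨p.1.erase p.2.2, insert p.2.2 p.2.1, p.2.2⟩) ?_ ?_ ?_ ?_ ?_
  · rintro ⟨S, U, j⟩ h
    simp only [mem_sigma, mem_powersetCard_univ, mem_sdiff] at h ⊢
    obtain ⟨hS, hU, hj, hj'⟩ := h
    simp [card_insert_of_notMem hj', card_erase_of_mem hj, hS, hU]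
  · rintro ⟨S, U, j⟩ h
    simp only [mem_sigma, mem_powersetCard_univ, mem_sdiff] at h ⊢
    obtain ⟨hS, hU, hj, hj'⟩ := h
    simp [card_insert_of_notMem hj', card_erase_of_mem hj, hS, hU]
  · rintro ⟨S, U, j⟩ h
    simp only [mem_sigma, mem_powersetCard_univ, mem_sdiff] at h ⊢
    obtain ⟨hS, hU, hj, hj'⟩ := h
    simp [erase_insert hj', insert_erase hj]
  · rintro ⟨S, U, j⟩ h
    simp only [mem_sigma, mem_powersetCard_univ, mem_sdiff] at h ⊢
    obtain ⟨hS, hU, hj, hj'⟩ := h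
    simp [erase_insert hj', insert_erase hj]
  · rintro ⟨S, U, j⟩ h
    simp only [mem_sigma, mem_powersetCard_univ, mem_sdiff] at h ⊢
    obtain ⟨hS, hU, hj, hj'⟩ := h
    have e1 : (U \ S).card = (insert j S \ U.erase j).card := by
      have a := Finset.card_sdiff_add_card U S
      have b := Finset.card_sdiff_add_card (insert j S) (U.erase j)
      have c : insert j S ∪ U.erase j = U ∪ S := by
        ext k
        by_cases hk : k = j <;> simp [hk, hj, or_comm]
      rw [c, card_erase_of_mem hj] at b
      omega
    rw [e1, prod_insert hj', ← mul_prod_erase U x hj]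
    ring

noncomputable def e (x : Fin n → ℝ) (m : ℕ) : ℝ := ∑ T ∈ powersetCard m univ, ∏ k ∈ T, x k

lemma e_pos (x : Fin n → ℝ) (hx : ∀ i, 0 < x i) (m : ℕ) (hm : m ≤ n) : 0 < e x m := by
  unfold e
  apply sum_pos
  · intro T _
    exact prod_pos fun i _ => hx i
  · rw [powersetCard_nonempty]; simpa using hm

lemma kernel (x : Fin n → ℝ) (hx : ∀ i, 0 < x i) (m : ℕ) (hm : m < n) :
    ∃ K : Finset (Fin n) → Fin n → ℝ, (∀ S j, 0 ≤ K S j) ∧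
      (∀ S, S.card = m → ∑ j ∈ Sᶜ, K S j = 1) ∧
      ∀ g : Finset (Fin n) → ℝ,
        ∑ S ∈ powersetCard m univ, (∏ k ∈ S, x k) / e x m * ∑ j ∈ Sᶜ, K S j * g (insert j S) =
        ∑ T ∈ powersetCard (m+1) univ, (∏ k ∈ T, x k) / e x (m+1) * g T := by
  have p1 := e_pos x hx m hm.le
  have p2 := e_pos x hx (m+1) hm
  have key : ∀ (S : Finset (Fin n)) (f : Fin n → ℝ),
      ∑ j ∈ Sᶜ, (∑ U ∈ powersetCard (m+1) univ,
        if j ∈ U then (∏ k ∈ U, x k) / ((U \ S).card : ℝ) / e x (m+1) else 0) * f j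
      = ∑ U ∈ powersetCard (m+1) univ, ∑ j ∈ U \ S,
        (∏ k ∈ U, x k) / ((U \ S).card : ℝ) / e x (m+1) * f j := by
    intro S f
    simp only [sum_mul]
    rw [sum_comm]
    refine sum_congr rfl fun U _ => ?_
    have : U \ S = Sᶜ.filter (· ∈ U) := by ext k; simp [and_comm]
    simp only [ite_mul, zero_mul]
    rw [← sum_filter, ← this]
  refine ⟨fun S j => ∑ U ∈ powersetCard (m+1) univ,
    if j ∈ U then (∏ k ∈ U, x k) / ((U \ S).card : ℝ) / e x (m+1) else 0, ?_, ?_, ?_⟩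
  · intro S j
    refine sum_nonneg fun U _ => ?_
    have := prod_pos fun i (_ : i ∈ U) => hx i
    split_ifs <;> positivity
  · intro S hS
    have := key S (fun _ => 1)
    simp only [mul_one] at this
    rw [this]
    have : ∀ U ∈ powersetCard (m+1) (univ : Finset (Fin n)), ∑ j ∈ U \ S,
        (∏ k ∈ U, x k) / ((U \ S).card : ℝ) / e x (m+1) = (∏ k ∈ U, x k) / e x (m+1) := by
      intro U hU
      rw [mem_powersetCard_univ] at hU
      have := card_sdiff_pos_of hS hU
      have h' : ((U \ S).card : ℝ) ≠ 0 := by positivity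
      rw [sum_const, nsmul_eq_mul]
      field_simp
    rw [sum_congr rfl this, ← sum_div]
    exact div_self p2.ne'
  · intro g
    have h := swap_sum x m g
    have h2 : ∑ T ∈ powersetCard (m+1) univ, ∑ V ∈ powersetCard m univ, 
      (∏ k ∈ T, x k) * (∏ k ∈ V, x k) * g T
      = e x m * e x (m+1) * ∑ T ∈ powersetCard (m+1) univ, (∏ k ∈ T, x k) / e x (m+1) * g T := by
      rw [mul_sum]
      refine sum_congr rfl fun T _ => ?_
      rw [← sum_mul, ← mul_sum]
      change _ * e x m * _ = _
      field_simp
    rw [h2] at h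
    have h3 : e x m * e x (m+1) ≠ 0 := by positivity
    apply mul_left_cancel₀ h3
    rw [← h, mul_sum]
    refine sum_congr rfl fun S _ => ?_
    rw [key S (fun j => g (insert j S)), mul_sum, mul_sum]
    refine sum_congr rfl fun U _ => ?_
    rw [mul_sum, mul_sum]
    refine sum_congr rfl fun j _ => ?_
    field_simp

lemma build (x : Fin n → ℝ) (hx : ∀ i, 0 < x i) (m : ℕ) (hm : m ≤ n) :
    ∃ (Ω : Type) (_ : Fintype Ω) (w : Ω → ℝ) (W : ℕ → Ω → Finset (Fin n)),
      (∀ ω, 0 ≤ w ω) ∧ (∀ ω, W 0 ω = ∅) ∧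
      (∀ i, i ≤ m → ∀ ω, (W i ω).card = i) ∧
      (∀ i, i < m → ∀ ω, ∃ j, j ∉ W i ω ∧ W (i+1) ω = insert j (W i ω)) ∧
      ∀ i, i ≤ m → ∀ g : Finset (Fin n) → ℝ,
        ∑ ω, w ω * g (W i ω) = ∑ S ∈ powersetCard i univ, (∏ k ∈ S, x k) / e x i * g S := by
  induction m with
  | zero =>
    refine ⟨Unit, inferInstance, fun _ => 1, fun _ _ => ∅, by simp, by simp, ?_, by simp, ?_⟩
    · intro i hi; simp; omega
    · intro i hi g
      obtain rfl : i = 0 := by omega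
      simp [e]
  | succ m ih =>
    obtain ⟨Ω, _, w, W, hw, h0, hc, hs, hl⟩ := ih (by omega)
    obtain ⟨K, hK, hK1, hKg⟩ := kernel x hx m hm
    have sub : ∀ (ω : Ω) (f : Fin n → ℝ), ∑ j : {j // j ∈ (W m ω)ᶜ}, f j.1 = ∑ j ∈ (W m ω)ᶜ, f j :=
      fun ω f => Finset.sum_coe_sort _ f
    refine ⟨Σ ω : Ω, {j // j ∈ (W m ω)ᶜ}, inferInstance,
      fun q => w q.1 * K (W m q.1) q.2.1,
      fun i q => if i ≤ m then W i q.1 else insert q.2.1 (W m q.1), ?_, ?_, ?_, ?_, ?_⟩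
    · exact fun q => mul_nonneg (hw _) (hK _ _)
    · intro q; simp [h0]
    · rintro i hi ⟨ω, j, hj⟩
      rw [mem_compl] at hj
      by_cases h : i ≤ m
      · simp [h, hc i h]
      · simp only [h, if_false]
        rw [card_insert_of_notMem hj, hc m le_rfl]
        omega
    · rintro i hi ⟨ω, j, hj⟩
      rw [mem_compl] at hj
      by_cases h : i < m
      · obtain ⟨k, hk⟩ := hs i h ω
        refine ⟨k, ?_⟩
        simpa [h.le, Nat.succ_le_of_lt h] using hk
      · obtain rfl : i = m := by omega
        exact ⟨j, by simpa using hj, by simp⟩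
    · intro i hi g
      rw [Fintype.sum_sigma]
      by_cases h : i ≤ m
      · rw [← hl i h g]
        refine sum_congr rfl fun ω _ => ?_
        simp only [h, if_true]
        rw [sub ω (fun j => w ω * K (W m ω) j * g (W i ω)), ← sum_mul, ← mul_sum,
          hK1 _ (hc m le_rfl ω), mul_one]
      · obtain rfl : i = m + 1 := by omega
        rw [← hKg g, ← hl m le_rfl (fun S => ∑ j ∈ Sᶜ, K S j * g (insert j S))]
        refine sum_congr rfl fun ω _ => ?_
        simp only [h, if_false]
        rw [sub ω (fun j => w ω * K (W m ω) j * g (insert j (W m ω))), mul_sum]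
        exact sum_congr rfl fun j _ => by ring

end MonoCoupling


/-- Lemma 5.4: the monotone coupling of the conditioned Bernoulli configurations.
The conditional law of `ω` given `|ω| = i` assigns to the indicator of a set `S`
of cardinality `i` a probability proportional to `∏_{j ∈ S} r j / (1 - r j)`. -/
theorem exists_monotone_coupling (n : ℕ) (hn : 1 ≤ n) (r : Fin n → ℝ)
    (hr : ∀ i, 0 < r i ∧ r i < 1) :
    ∃ (Ω : Type) (mΩ : MeasurableSpace Ω) (P : Measure Ω),
      IsProbabilityMeasure P ∧
      ∃ W : ℕ → Ω → (Fin n → Bool),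
        (∀ i, Measurable (W i)) ∧
        (∀ ω, W 0 ω = fun _ => false) ∧
        (∀ ω, W n ω = fun _ => true) ∧
        (∀ i, i < n → ∀ ω, ∃ j : Fin n, W i ω j = false ∧
          W (i + 1) ω = Function.update (W i ω) j true) ∧
        (∀ i, i ≤ n → ∀ S : Finset (Fin n), S.card = i →
          P {ω | W i ω = fun j => decide (j ∈ S)} =
            ENNReal.ofReal ((∏ j ∈ S, r j / (1 - r j)) /
              (∑ T ∈ Finset.powersetCard i Finset.univ, ∏ j ∈ T, r j / (1 - r j)))) := by
  classical
  have hx : ∀ i, 0 < r i / (1 - r i) := fun i => div_pos (hr i).1 (by linarith [(hr i).2])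
  obtain ⟨Ω, _, w, W, hw, h0, hc, hs, hl⟩ :=
    MonoCoupling.build (fun i => r i / (1 - r i)) hx n le_rfl
  have hsum : ∑ ω, ENNReal.ofReal (w ω) = 1 := by
    rw [← ENNReal.ofReal_sum_of_nonneg fun ω _ => hw ω]
    have := hl 0 (Nat.zero_le _) (fun _ => 1)
    simp [MonoCoupling.e] at this
    rw [this, ENNReal.ofReal_one]
  let p : PMF Ω := PMF.ofFintype (fun ω => ENNReal.ofReal (w ω)) hsum
  letI : MeasurableSpace Ω := ⊤
  refine ⟨Ω, ⊤, p.toMeasure, inferInstance,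
    fun i ω j => decide (j ∈ W i ω), ?_, ?_, ?_, ?_, ?_⟩
  · intro i
    exact fun _ _ => trivial
  · intro ω; simp [h0]
  · intro ω
    have : W n ω = Finset.univ := by
      rw [← Finset.card_eq_iff_eq_univ, hc n le_rfl, Fintype.card_fin]
    simp [this]
  · intro i hi ω
    obtain ⟨j, hj, h⟩ := hs i hi ω
    refine ⟨j, by simpa using hj, ?_⟩
    funext k
    by_cases hk : k = j
    · subst hk; simp [h]
    · simp [h, hk]
  · intro i hi S hS
    have hset : {ω | (fun j => decide (j ∈ W i ω)) = fun j => decide (j ∈ S)}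
        = {ω | W i ω = S} := by
      ext ω
      simp [funext_iff, Finset.ext_iff]
    rw [hset, PMF.toMeasure_apply_fintype]
    have h := hl i hi (fun T => if T = S then 1 else 0)
    simp only [mul_ite, mul_one, mul_zero] at h
    rw [Finset.sum_ite_eq' , if_pos (by simpa using hS)] at h
    unfold MonoCoupling.e at h
    rw [← h, ENNReal.ofReal_sum_of_nonneg]
    · refine Finset.sum_congr rfl fun ω _ => ?_
      by_cases hω : W i ω = S <;> simp [Set.indicator, hω, p]
    · intro ω _
      split_ifs
      · exact hw ω
      · exact le_rfl
end

section
/- Let n ≥ 1 and x₁, …, x_n > 0. For S ⊆ {1,…,n} set σ_S = ∏_{i∈S} x_i, and for 0 ≤ i ≤ n set Σ_i = Σ_{S: |S|=i} σ_S (so Σ_0 = 1). For S with |S| = i < n and j ∉ S define p_{S,S∪{j}} = (1/Σ_{i+1}) · Σ_{T: j∈T, |T|=i+1} σ_T/(i+1 − |S ∩ T|). Then: (a) p_{S,S∪{j}} ∈ [0,1] and Σ_{j∉S} p_{S,S∪{j}} = 1 for every S with |S| = i < n; and (b) for every T ⊆ {1,…,n} with |T| = i+1: Σ_{j∈T} (σ_{T\{j}}/Σ_i)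 · p_{T\{j},T} = σ_T/Σ_{i+1}. -/
/-- The weight `σ_S = ∏_{i ∈ S} x i` of a subset. -/
noncomputable def sigWeight {n : ℕ} (x : Fin n → ℝ) (S : Finset (Fin n)) : ℝ :=
  ∏ i ∈ S, x i

/-- The level sums `Σ_i = ∑_{|S| = i} σ_S` (the elementary symmetric sums). -/
noncomputable def SigSum {n : ℕ} (x : Fin n → ℝ) (i : ℕ) : ℝ :=
  ∑ S ∈ Finset.powersetCard i Finset.univ, sigWeight x S

/-- The transition probabilities
`p_{S, S ∪ {j}} = (1/Σ_{i+1}) ∑_{T : j ∈ T, |T| = i+1} σ_T / (i + 1 - |S ∩ T|)`. -/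
noncomputable def transP {n : ℕ} (x : Fin n → ℝ) (S : Finset (Fin n)) (j : Fin n) : ℝ :=
  (∑ T ∈ (Finset.powersetCard (S.card + 1) Finset.univ).filter (fun T => j ∈ T),
    sigWeight x T / ((S.card : ℝ) + 1 - ((S ∩ T).card : ℝ))) / SigSum x (S.card + 1)

theorem sigWeight_pos' {n : ℕ} (x : Fin n → ℝ) (hx : ∀ i, 0 < x i) (S : Finset (Fin n)) :
    0 < sigWeight x S := Finset.prod_pos fun i _ => hx i

theorem SigSum_pos' {n : ℕ} (x : Fin n → ℝ) (hx : ∀ i, 0 < x i) (i : ℕ) (hi : i ≤ n) :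
    0 < SigSum x i := by
  apply Finset.sum_pos (fun S _ => sigWeight_pos' x hx S)
  apply Finset.powersetCard_nonempty.2
  simpa using hi

theorem transP_nonneg' {n : ℕ} (x : Fin n → ℝ) (hx : ∀ i, 0 < x i) (S : Finset (Fin n))
    (hS : S.card < n) (j : Fin n) : 0 ≤ transP x S j := by
  apply div_nonneg _ (SigSum_pos' x hx _ hS).le
  apply Finset.sum_nonneg
  intro T _
  apply div_nonneg (sigWeight_pos' x hx T).le
  have : ((S ∩ T).card : ℝ) ≤ S.card := by
    exact_mod_cast Finset.card_le_card Finset.inter_subset_left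
  linarith

theorem transP_sum' {n : ℕ} (x : Fin n → ℝ) (hx : ∀ i, 0 < x i) (S : Finset (Fin n))
    (hS : S.card < n) : ∑ j ∈ Sᶜ, transP x S j = 1 := by
  unfold transP
  rw [← Finset.sum_div, div_eq_one_iff_eq (SigSum_pos' x hx _ hS).ne']
  simp_rw [Finset.sum_filter]
  rw [Finset.sum_comm]
  unfold SigSum
  apply Finset.sum_congr rfl
  intro T hT
  have hc : T.card = S.card + 1 := (Finset.mem_powersetCard.1 hT).2
  rw [← Finset.sum_filter, Finset.sum_const, nsmul_eq_mul]
  have h1 : Sᶜ.filter (fun j => j ∈ T) = T \ S := by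
    ext a; simp [and_comm]
  have h2 : ((T \ S).card : ℝ) = (S.card : ℝ) + 1 - ((S ∩ T).card : ℝ) := by
    have h3 := Finset.card_sdiff_add_card_inter T S
    rw [Finset.inter_comm, hc] at h3
    have h4 : ((T \ S).card : ℝ) + ((S ∩ T).card : ℝ) = (S.card : ℝ) + 1 := by exact_mod_cast h3
    linarith
  have h5 : ((S ∩ T).card : ℝ) ≤ S.card := by
    exact_mod_cast Finset.card_le_card Finset.inter_subset_left
  rw [h1, h2]
  apply mul_div_cancel₀
  linarith

theorem sum_reindex' {n : ℕ} (j : Fin n) (m : ℕ) (f : Finset (Fin n) → ℝ) :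
    ∑ U ∈ (Finset.powersetCard (m + 1) Finset.univ).filter (fun U => j ∈ U), f U =
    ∑ V ∈ (Finset.powersetCard m Finset.univ).filter (fun V => j ∉ V), f (insert j V) := by
  symm
  refine Finset.sum_nbij' (fun V => insert j V) (fun U => U.erase j) ?_ ?_ ?_ ?_ ?_
  · intro V hV
    simp only [Finset.mem_filter, Finset.mem_powersetCard_univ] at hV ⊢
    simp [Finset.card_insert_of_notMem hV.2, hV.1]
  · intro U hU
    simp only [Finset.mem_filter, Finset.mem_powersetCard_univ] at hU ⊢
    simp [Finset.card_erase_of_mem hU.2, hU.1]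
  · intro V hV
    exact Finset.erase_insert (Finset.mem_filter.1 hV).2
  · intro U hU
    exact Finset.insert_erase (Finset.mem_filter.1 hU).2
  · intro V _
    rfl

theorem push' {n : ℕ} (x : Fin n → ℝ) (hx : ∀ i, 0 < x i) (T : Finset (Fin n))
    (m : ℕ) (hT : T.card = m + 1) :
    ∑ j ∈ T, sigWeight x (T.erase j) / SigSum x m * transP x (T.erase j) j =
          sigWeight x T / SigSum x (m + 1) := by
  have hmn : m + 1 ≤ n := by
    rw [← hT]; simpa using Finset.card_le_univ T
  have hp := SigSum_pos' x hx m (by omega)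
  have hp1 := SigSum_pos' x hx (m + 1) hmn
  have key : ∀ j ∈ T, sigWeight x (T.erase j) / SigSum x m * transP x (T.erase j) j =
      (∑ V ∈ Finset.powersetCard m Finset.univ, if j ∉ V then
        sigWeight x V / ((T \ V).card : ℝ) else 0) *
        (sigWeight x T / (SigSum x m * SigSum x (m + 1))) := by
    intro j hj
    have hc : (T.erase j).card = m := by rw [Finset.card_erase_of_mem hj, hT]; rfl
    unfold transP
    rw [hc, sum_reindex', ← Finset.sum_filter, Finset.sum_div, Finset.mul_sum, Finset.sum_mul]
    apply Finset.sum_congr rfl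
    intro V hV
    have hjV := (Finset.mem_filter.1 hV).2
    have e1 : sigWeight x (insert j V) = x j * sigWeight x V := Finset.prod_insert hjV
    have e2 : sigWeight x T = x j * sigWeight x (T.erase j) :=
      (Finset.mul_prod_erase T x hj).symm
    have e3 : T.erase j ∩ insert j V = T ∩ V := by
      ext a
      simp only [Finset.mem_inter, Finset.mem_erase, Finset.mem_insert]
      by_cases h : a = j
      · subst h; simp [hjV]
      · simp [h]
    have h3 := Finset.card_sdiff_add_card_inter T V
    rw [hT] at h3
    have h4 : ((T \ V).card : ℝ) + ((T ∩ V).card : ℝ) = (m : ℝ) + 1 := by exact_mod_cast h3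
    have h5 : (m : ℝ) + 1 - ((T ∩ V).card : ℝ) = ((T \ V).card : ℝ) := by linarith
    rw [e1, e2, e3, h5]
    have h6 : ((T \ V).card : ℝ) ≠ 0 := by
      have : j ∈ T \ V := Finset.mem_sdiff.2 ⟨hj, hjV⟩
      exact_mod_cast (Finset.card_pos.2 ⟨j, this⟩).ne'
    field_simp
  rw [Finset.sum_congr rfl key, ← Finset.sum_mul, Finset.sum_comm]
  have : (∑ V ∈ Finset.powersetCard m Finset.univ, ∑ j ∈ T, if j ∉ V then
        sigWeight x V / ((T \ V).card : ℝ) else 0) = SigSum x m := by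
    unfold SigSum
    apply Finset.sum_congr rfl
    intro V hV
    have hVc : V.card = m := (Finset.mem_powersetCard.1 hV).2
    rw [← Finset.sum_filter, Finset.sum_const, nsmul_eq_mul, Finset.filter_notMem_eq_sdiff]
    apply mul_div_cancel₀
    have h7 := Finset.le_card_sdiff V T
    have : (T \ V).card ≠ 0 := by omega
    exact_mod_cast this
  rw [this]
  field_simp

/-- Lemma A.3: the kernel `p` is stochastic and maps the normalized level-`i`
weights to the normalized level-`(i+1)` weights. -/
theorem coupling_kernel_identities (n : ℕ) (hn : 1 ≤ n) (x : Fin n → ℝ)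
    (hx : ∀ i, 0 < x i) :
    (∀ S : Finset (Fin n), S.card < n → ∀ j ∉ S,
        0 ≤ transP x S j ∧ transP x S j ≤ 1) ∧
    (∀ S : Finset (Fin n), S.card < n → ∑ j ∈ Sᶜ, transP x S j = 1) ∧
    (∀ T : Finset (Fin n), T.Nonempty →
        ∑ j ∈ T, sigWeight x (T.erase j) / SigSum x (T.card - 1) * transP x (T.erase j) j =
          sigWeight x T / SigSum x T.card) := by
  refine ⟨fun S hS j hj => ⟨transP_nonneg' x hx S hS j, ?_⟩, transP_sum' x hx, ?_⟩
  · rw [← transP_sum' x hx S hS]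
    exact Finset.single_le_sum (f := fun j => transP x S j)
      (fun k _ => transP_nonneg' x hx S hS k) (Finset.mem_compl.2 hj)
  · intro T hT
    obtain ⟨m, hm⟩ : ∃ m, T.card = m + 1 := ⟨T.card - 1, by have := hT.card_pos; omega⟩
    rw [hm]
    exact push' x hx T m hm
end
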